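/- Let G be a finite simple graph on a finite vertex set V and let U ≤ G be a spanning subgraph. Then U is a fixing subgraph of G if and only if x(U;G) = |A(U)| / |A(U) ∩ A(G)|. -/

import Mathlib

/-- `σ` is an automorphism of the simple graph `G`. -/
def IsAut {V : Type*} (G : SimpleGraph V) (σ : Equiv.Perm V) : Prop :=
  ∀ u v, G.Adj (σ u) (σ v) ↔ G.Adj u v

/-- `|A(G)|`, the number of automorphisms of `G`. -/
noncomputable def autCard {V : Type*} (G : SimpleGraph V) : ℕ :=
  Nat.card {σ : Equiv.Perm V // IsAut G σ}

/-- `|A(U) ∩ A(G)|`, the number of common automorphisms of `U` and `G`. -/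
noncomputable def autCapCard {V : Type*} (U G : SimpleGraph V) : ℕ :=
  Nat.card {σ : Equiv.Perm V // IsAut U σ ∧ IsAut G σ}

/-- `s(U;G)`: the number of spanning subgraphs of `G` isomorphic to `U`. -/
noncomputable def sCard {V : Type*} (U G : SimpleGraph V) : ℕ :=
  Nat.card {U' : SimpleGraph V // U' ≤ G ∧ Nonempty (U' ≃g U)}

/-- `x(U;G)`: the number of graphs `X` on `V` with `U ≤ X` and `X` isomorphic to `G`. -/
noncomputable def xCard {V : Type*} (U G : SimpleGraph V) : ℕ :=
  Nat.card {X : SimpleGraph V // U ≤ X ∧ Nonempty (X ≃g G)}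

/-- `s₀(U;G)`: the number of spanning subgraphs of `G` that are `G`-similar to `U`,
i.e. images of `U` under an automorphism of `G`. -/
noncomputable def s0Card {V : Type*} (U G : SimpleGraph V) : ℕ :=
  Nat.card {U' : SimpleGraph V //
    U' ≤ G ∧ ∃ σ : Equiv.Perm V, IsAut G σ ∧ U.map σ.toEmbedding = U'}

/-- `U` is a fixing subgraph of `G`: it is a spanning subgraph and
`s(U;G) = |A(G)| / |A(U) ∩ A(G)|`. -/
noncomputable def IsFixing {V : Type*} (U G : SimpleGraph V) : Prop :=
  U ≤ G ∧ sCard U G = autCard G / autCapCard U G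

/-- `U` is a strong fixing subgraph of `G`: a fixing subgraph all of whose
automorphisms are automorphisms of `G`. -/
noncomputable def IsStrongFixing {V : Type*} (U G : SimpleGraph V) : Prop :=
  IsFixing U G ∧ ∀ σ : Equiv.Perm V, IsAut U σ → IsAut G σ

/-- `C` is a hamiltonian cycle of `G`: a connected 2-regular spanning subgraph. -/
def IsHamCycle {V : Type*} (G C : SimpleGraph V) : Prop :=
  C ≤ G ∧ C.Connected ∧ ∀ v, Nat.card {w // C.Adj v w} = 2

/-- `G ∈ F(HAM)`: `G` is hamiltonian and every hamiltonian cycle of `G` is a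
fixing subgraph of `G`. -/
noncomputable def InFHAM {V : Type*} (G : SimpleGraph V) : Prop :=
  (∃ C, IsHamCycle G C) ∧ ∀ C, IsHamCycle G C → IsFixing C G

/-- `G ∈ F*(HAM)`: `G` is hamiltonian and every hamiltonian cycle of `G` is a
strong fixing subgraph of `G`. -/
noncomputable def InFstarHAM {V : Type*} (G : SimpleGraph V) : Prop :=
  (∃ C, IsHamCycle G C) ∧ ∀ C, IsHamCycle G C → IsStrongFixing C G

/-- The generalized Petersen graph `G(n,k)`, with outer vertices `Sum.inl i = aᵢ`
and inner vertices `Sum.inr i = bᵢ`, edges `aᵢaᵢ₊₁`, `aᵢbᵢ`, `bᵢbᵢ₊ₖ`. -/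
def genPetersen (n k : ℕ) : SimpleGraph (ZMod n ⊕ ZMod n) :=
  SimpleGraph.fromRel fun v w =>
    match v, w with
    | Sum.inl i, Sum.inl j => j = i + 1
    | Sum.inl i, Sum.inr j => j = i
    | Sum.inr i, Sum.inr j => j = i + (k : ZMod n)
    | _, _ => False

/-- The Heawood graph on `ZMod 14`: `i ~ i+1` for all `i`, and `i ~ i+5` for even `i`
(LCF notation `[5,-5]⁷`). -/
def heawood : SimpleGraph (ZMod 14) :=
  SimpleGraph.fromRel fun i j => j = i + 1 ∨ (Even i.val ∧ j = i + 5)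

/-- The spanning cycle of the Heawood graph through `0, 1, …, 13` in order. -/
def heawoodCycle : SimpleGraph (ZMod 14) :=
  SimpleGraph.fromRel fun i j => j = i + 1

def autSub {V : Type*} (G : SimpleGraph V) : Subgroup (Equiv.Perm V) where
  carrier := {σ | IsAut G σ}
  one_mem' := fun u v => Iff.rfl
  mul_mem' := fun {a b} ha hb u v => (ha (b u) (b v)).trans (hb u v)
  inv_mem' := fun {a} ha u v => by
    have := ha (a⁻¹ u) (a⁻¹ v)
    simpa using this.symm

theorem card_comap_aux {V : Type*} [Fintype V] (H : SimpleGraph V)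
    (p : SimpleGraph V → Prop) :
    Nat.card {σ : Equiv.Perm V // p (H.comap σ)} =
      Nat.card {X : SimpleGraph V // p X ∧ Nonempty (X ≃g H)} * autCard H := by
  classical
  unfold autCard
  rw [← Nat.card_prod]
  have φ : ∀ X : {X : SimpleGraph V // p X ∧ Nonempty (X ≃g H)}, X.1 ≃g H :=
    fun X => X.2.2.some
  have key : ∀ (X : {X : SimpleGraph V // p X ∧ Nonempty (X ≃g H)})
      (a : {σ : Equiv.Perm V // IsAut H σ}),
      H.comap ((φ X).toEquiv.trans a.1) = X.1 := by
    intro X a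
    ext u v
    simp only [SimpleGraph.comap_adj, Equiv.trans_apply]
    exact (a.2 _ _).trans (φ X).map_rel_iff
  symm
  refine Nat.card_eq_of_bijective
    (fun q => ⟨(φ q.1).toEquiv.trans q.2.1, by rw [key]; exact q.1.2.1⟩) ⟨?_, ?_⟩
  · rintro ⟨X, a⟩ ⟨Y, b⟩ h
    have h1 : (φ X).toEquiv.trans a.1 = (φ Y).toEquiv.trans b.1 := congrArg Subtype.val h
    have hXY : X = Y := by
      apply Subtype.ext
      rw [← key X a, ← key Y b, h1]
    subst hXY
    congr 1
    apply Subtype.ext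
    ext u
    have := Equiv.congr_fun h1 ((φ X).toEquiv.symm u)
    simpa using this
  · rintro ⟨σ, hσ⟩
    let X : {X : SimpleGraph V // p X ∧ Nonempty (X ≃g H)} :=
      ⟨H.comap σ, hσ, ⟨⟨σ, Iff.rfl⟩⟩⟩
    refine ⟨⟨X, ⟨(φ X).toEquiv.symm.trans σ, ?_⟩⟩, ?_⟩
    · intro u v
      exact (φ X).symm.map_rel_iff
    · apply Subtype.ext
      ext u
      simp only [Equiv.trans_apply]
      exact congrArg σ ((φ X).toEquiv.symm_apply_apply u)

/-- **Theorem 5(i).** `U` is a fixing subgraph of `G` iff `x(U;G) = |A(U)|/|A(U) ∩ A(G)|`. -/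
theorem isFixing_iff_xCard {V : Type*} [Fintype V] (U G : SimpleGraph V) (hUG : U ≤ G) :
    IsFixing U G ↔ xCard U G = autCard U / autCapCard U G := by
  have e1 := card_comap_aux G (fun X => U ≤ X)
  have e2 := card_comap_aux U (fun X => X ≤ G)
  have e3 : Nat.card {σ : Equiv.Perm V // U ≤ G.comap σ} =
      Nat.card {σ : Equiv.Perm V // U.comap σ ≤ G} := by
    refine Nat.card_congr ((Equiv.inv (Equiv.Perm V)).subtypeEquiv ?_)
    intro σ
    constructor
    · intro h u v huv
      have := h huv
      simpa using this
    · intro h u v huv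
      have : (U.comap (σ⁻¹ : Equiv.Perm V)).Adj (σ u) (σ v) := by simpa using huv
      exact h this
  have e : xCard U G * autCard G = sCard U G * autCard U := by
    unfold xCard sCard
    rw [← e1, ← e2, e3]
  have hc : autCapCard U G = Nat.card (autSub U ⊓ autSub G : Subgroup (Equiv.Perm V)) := rfl
  have hg : autCard G = Nat.card (autSub G) := rfl
  have hu : autCard U = Nat.card (autSub U) := rfl
  have c0 : 0 < autCapCard U G := by rw [hc]; exact Nat.card_pos
  have g0 : 0 < autCard G := by rw [hg]; exact Nat.card_pos
  have u0 : 0 < autCard U := by rw [hu]; exact Nat.card_pos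
  have dg : autCapCard U G ∣ autCard G := by
    rw [hc, hg]; exact Subgroup.card_dvd_of_le inf_le_right
  have du : autCapCard U G ∣ autCard U := by
    rw [hc, hu]; exact Subgroup.card_dvd_of_le inf_le_left
  obtain ⟨k, hk⟩ := dg
  obtain ⟨l, hl⟩ := du
  unfold IsFixing
  rw [hk] at e g0 ⊢
  rw [hl] at e u0 ⊢
  rw [Nat.mul_div_cancel_left _ c0, Nat.mul_div_cancel_left _ c0]
  have k0 : 0 < k := Nat.pos_of_mul_pos_left g0
  have l0 : 0 < l := Nat.pos_of_mul_pos_left u0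
  have e' : xCard U G * k = sCard U G * l := by
    apply Nat.eq_of_mul_eq_mul_left c0
    linarith
  constructor
  · rintro ⟨-, h⟩
    rw [h, mul_comm k l] at e'
    exact Nat.eq_of_mul_eq_mul_right k0 e'
  · intro h
    refine ⟨hUG, ?_⟩
    rw [h, mul_comm l k] at e'
    exact (Nat.eq_of_mul_eq_mul_right l0 e').symm
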